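/- Each of the three monotones M_β(P) = P(I)+P(F), M_{|α|} and M_{|γ|,β} is necessary to determine the convertibility preorder on probability distributions over bit functions. Precisely: (1) there exist distributions P, Q with P(I)+P(F) = Q(I)+Q(F) and |P(I)−P(F)|·(Q(I)+Q(F)) = |Q(I)−Q(F)|·(P(I)+P(F)), but no free operation maps P to Q; (2) there exist distributions P, Q with P(I)+P(F) = Q(I)+Q(F) and (P(I)+P(F))·(1−|Q(R0)−Q(R1)|) = (Q(I)+Q(F))·(1−|P(R0)−P(R1)|), but no free operation maps P to Q; (3) there exist distributions P, Q with |P(I)−P(F)|·(Q(I)+Q(F)) = |Q(I)−Q(F)|·(P(I)+P(F)) and (P(I)+P(F))·(1−|Q(R0)−Q(R1)|) = (Q(I)+Q(F))·(1−|P(R0)−P(R1)|), but no free operation maps P to Q. -/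

import Mathlib

open Finset

/-- `P` is a probability distribution over the four bit functions. -/
def IsDist (P : (Bool → Bool) → ℝ) : Prop :=
  (∀ f, 0 ≤ P f) ∧ ∑ f : Bool → Bool, P f = 1

/-- `μ` is a probability distribution over pairs (pre-processing, post-processing),
specifying a free operation. -/
def IsFreeOp (μ : ((Bool → Bool) × (Bool → Bool)) → ℝ) : Prop :=
  (∀ gh, 0 ≤ μ gh) ∧ ∑ gh : (Bool → Bool) × (Bool → Bool), μ gh = 1

/-- The action `Γ_μ` of a free operation `μ` on a distribution `P` over bit functions:
`Γ_μ(P)(f') = ∑_{(g,h)} μ(g,h) · ∑_{f : h ∘ f ∘ g = f'} P(f)`. -/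
noncomputable def Gamma (μ : ((Bool → Bool) × (Bool → Bool)) → ℝ)
    (P : (Bool → Bool) → ℝ) : (Bool → Bool) → ℝ :=
  fun f' => ∑ gh : (Bool → Bool) × (Bool → Bool),
    μ gh * ∑ f : Bool → Bool, if gh.2 ∘ f ∘ gh.1 = f' then P f else 0

/-- The identity bit function `I`. -/
def bitI : Bool → Bool := id
/-- The flip bit function `F`. -/
def bitF : Bool → Bool := fun b => !b
/-- The reset-to-zero bit function `R0`. -/
def bitR0 : Bool → Bool := fun _ => false
/-- The reset-to-one bit function `R1`. -/
def bitR1 : Bool → Bool := fun _ => true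

lemma sum_bit (P : (Bool → Bool) → ℝ) :
    ∑ f : Bool → Bool, P f = P bitI + P bitF + P bitR0 + P bitR1 := by
  have h : (Finset.univ : Finset (Bool → Bool)) = {bitI, bitF, bitR0, bitR1} := by decide
  rw [h, Finset.sum_insert (by decide), Finset.sum_insert (by decide),
    Finset.sum_insert (by decide), Finset.sum_singleton]
  ring

/-- The distribution with given weights on I, F, R0, R1. -/
noncomputable def mk4 (a b c d : ℝ) : (Bool → Bool) → ℝ := fun f =>
  if f = bitI then a else if f = bitF then b else if f = bitR0 then c else d

lemma mk4_I (a b c d : ℝ) : mk4 a b c d bitI = a := if_pos rfl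
lemma mk4_F (a b c d : ℝ) : mk4 a b c d bitF = b := by
  simp +decide [mk4]
lemma mk4_R0 (a b c d : ℝ) : mk4 a b c d bitR0 = c := by
  simp +decide [mk4]
lemma mk4_R1 (a b c d : ℝ) : mk4 a b c d bitR1 = d := by
  simp +decide [mk4]

lemma mk4_dist {a b c d : ℝ} (ha : 0 ≤ a) (hb : 0 ≤ b) (hc : 0 ≤ c) (hd : 0 ≤ d)
    (h : a + b + c + d = 1) : IsDist (mk4 a b c d) := by
  refine ⟨fun f => ?_, ?_⟩
  · unfold mk4; split_ifs <;> assumption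
  · rw [sum_bit, mk4_I, mk4_F, mk4_R0, mk4_R1, h]

/-- A linear functional of the output which is bounded on every deterministic free operation
is bounded on every free operation. -/
lemma Gamma_mk4_le {a b c d : ℝ} (w : (Bool → Bool) → ℝ) (K : ℝ)
    (hK : ∀ g h : Bool → Bool, a * w (h ∘ bitI ∘ g) + b * w (h ∘ bitF ∘ g) +
      c * w (h ∘ bitR0 ∘ g) + d * w (h ∘ bitR1 ∘ g) ≤ K)
    (μ : ((Bool → Bool) × (Bool → Bool)) → ℝ) (hμ : IsFreeOp μ) :
    ∑ f', w f' * Gamma μ (mk4 a b c d) f' ≤ K := by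
  have e : ∑ f', w f' * Gamma μ (mk4 a b c d) f' = ∑ gh, μ gh *
      (a * w (gh.2 ∘ bitI ∘ gh.1) + b * w (gh.2 ∘ bitF ∘ gh.1) +
      c * w (gh.2 ∘ bitR0 ∘ gh.1) + d * w (gh.2 ∘ bitR1 ∘ gh.1)) := by
    simp only [Gamma, Finset.mul_sum]
    rw [Finset.sum_comm]
    refine Finset.sum_congr rfl fun gh _ => ?_
    rw [Finset.sum_comm, sum_bit]
    simp only [mk4_I, mk4_F, mk4_R0, mk4_R1, mul_ite, mul_zero, Finset.sum_ite_eq,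
      Finset.mem_univ, if_true]
    ring
  rw [e]
  calc _ ≤ ∑ gh, μ gh * K :=
        Finset.sum_le_sum fun gh _ => mul_le_mul_of_nonneg_left (hK _ _) (hμ.1 gh)
    _ = K := by rw [← Finset.sum_mul, hμ.2, one_mul]

lemma forall_bit {p : (Bool → Bool) → Prop} (h1 : p bitI) (h2 : p bitF) (h3 : p bitR0)
    (h4 : p bitR1) : ∀ f, p f := by
  intro f
  have : ∀ f : Bool → Bool, f = bitI ∨ f = bitF ∨ f = bitR0 ∨ f = bitR1 := by decide
  rcases this f with h | h | h | h <;> rw [h] <;> assumption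

lemma no_conv {a b c d a' b' c' d' : ℝ} (i j k l K : ℝ)
    (hK : ∀ g h : Bool → Bool, a * mk4 i j k l (h ∘ bitI ∘ g) + b * mk4 i j k l (h ∘ bitF ∘ g) +
      c * mk4 i j k l (h ∘ bitR0 ∘ g) + d * mk4 i j k l (h ∘ bitR1 ∘ g) ≤ K)
    (hlt : K < i * a' + j * b' + k * c' + l * d') :
    ¬ ∃ μ, IsFreeOp μ ∧ Gamma μ (mk4 a b c d) = mk4 a' b' c' d' := by
  rintro ⟨μ, hμ, h⟩
  have := Gamma_mk4_le (mk4 i j k l) K hK μ hμ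
  rw [h, sum_bit] at this
  simp only [mk4_I, mk4_F, mk4_R0, mk4_R1] at this
  linarith

/-- each of the three monotones `M_β`, `M_{|α|}`, `M_{|γ|,β}` is
necessary to determine the convertibility preorder: for each of the three, there is a
pair of distributions agreeing on the other two monotones (in cross-multiplied form)
that is nonetheless not freely convertible. -/
theorem stmt_14 :
    (∃ P Q : (Bool → Bool) → ℝ, IsDist P ∧ IsDist Q ∧
      P bitI + P bitF = Q bitI + Q bitF ∧
      |P bitI - P bitF| * (Q bitI + Q bitF) = |Q bitI - Q bitF| * (P bitI + P bitF) ∧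
      ¬ ∃ μ, IsFreeOp μ ∧ Gamma μ P = Q) ∧
    (∃ P Q : (Bool → Bool) → ℝ, IsDist P ∧ IsDist Q ∧
      P bitI + P bitF = Q bitI + Q bitF ∧
      (P bitI + P bitF) * (1 - |Q bitR0 - Q bitR1|)
        = (Q bitI + Q bitF) * (1 - |P bitR0 - P bitR1|) ∧
      ¬ ∃ μ, IsFreeOp μ ∧ Gamma μ P = Q) ∧
    (∃ P Q : (Bool → Bool) → ℝ, IsDist P ∧ IsDist Q ∧
      |P bitI - P bitF| * (Q bitI + Q bitF) = |Q bitI - Q bitF| * (P bitI + P bitF) ∧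
      (P bitI + P bitF) * (1 - |Q bitR0 - Q bitR1|)
        = (Q bitI + Q bitF) * (1 - |P bitR0 - P bitR1|) ∧
      ¬ ∃ μ, IsFreeOp μ ∧ Gamma μ P = Q) := by
  refine ⟨⟨mk4 (1/2) 0 (1/4) (1/4), mk4 (1/2) 0 (1/2) 0, mk4_dist ?_ ?_ ?_ ?_ ?_,
      mk4_dist ?_ ?_ ?_ ?_ ?_, ?_, ?_, no_conv 2 0 1 (-1) (5/4) ?_ ?_⟩,
    ⟨mk4 (1/2) (1/2) 0 0, mk4 1 0 0 0, mk4_dist ?_ ?_ ?_ ?_ ?_,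
      mk4_dist ?_ ?_ ?_ ?_ ?_, ?_, ?_, no_conv 1 (-1) 0 0 0 ?_ ?_⟩,
    ⟨mk4 (1/2) 0 (1/2) 0, mk4 1 0 0 0, mk4_dist ?_ ?_ ?_ ?_ ?_,
      mk4_dist ?_ ?_ ?_ ?_ ?_, ?_, ?_, no_conv 1 0 0 0 (1/2) ?_ ?_⟩⟩
  all_goals first
    | (norm_num [mk4_I, mk4_F, mk4_R0, mk4_R1, abs_of_pos]; done)
    | (apply forall_bit <;> apply forall_bit <;> norm_num +decide [mk4])
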